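/- Work in ℂ[x₀,x₁,x₂,x₃,x₄] with the degree reverse lexicographic monomial order (x₀ > x₁ > x₂ > x₃ > x₄). Let f be a nonzero homogeneous polynomial of degree 5 each of whose monomials involves only x₀, x₁, x₂ and whose coefficient of x₂⁵ is zero, and let g be a nonzero homogeneous polynomial of degree 5 each of whose monomials involves only x₂, x₃, x₄ and whose coefficient of x₂⁵ is zero. Let I_C = (x₁x₄, x₀x₄, x₁x₃, x₀x₃, f, g). Then the initial ideal of I_C equals (x₁x₄, x₀x₄, x₁x₃, x₀x₃, lm(f), lm(g)). In particular, I_C admits a Gröbner basis consisting of elements of degree at most 5. -/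

import Mathlib

open MvPolynomial

/-- Degree reverse lexicographic order on exponent vectors (with `x₀ > x₁ > ⋯ > x₄`):
`a < b` iff `a` has smaller total degree, or the degrees agree and at the largest
index where they differ, `a` has the larger exponent. -/
def RevLexLT (a b : Fin 5 →₀ ℕ) : Prop :=
  (a.sum fun _ n => n) < (b.sum fun _ n => n) ∨
    ((a.sum fun _ n => n) = (b.sum fun _ n => n) ∧
      ∃ i : Fin 5, b i < a i ∧ ∀ j : Fin 5, i < j → a j = b j)

/-- `d` is the exponent vector of the leading monomial of `h` for the degrevlex order. -/
def IsLeadExp (h : MvPolynomial (Fin 5) ℂ) (d : Fin 5 →₀ ℕ) : Prop :=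
  d ∈ h.support ∧ ∀ e ∈ h.support, e ≠ d → RevLexLT e d

/-- The initial ideal of `I` for the degrevlex order: the ideal generated by the
leading monomials of the nonzero elements of `I`. -/
noncomputable def initialIdeal (I : Ideal (MvPolynomial (Fin 5) ℂ)) :
    Ideal (MvPolynomial (Fin 5) ℂ) :=
  Ideal.span {p | ∃ h ∈ I, ∃ d : Fin 5 →₀ ℕ, IsLeadExp h d ∧ p = monomial d (1 : ℂ)}

theorem revLexLT_iff (a b : Fin 5 →₀ ℕ) :
    RevLexLT a b ↔
      a 0 + a 1 + a 2 + a 3 + a 4 < b 0 + b 1 + b 2 + b 3 + b 4 ∨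
      (a 0 + a 1 + a 2 + a 3 + a 4 = b 0 + b 1 + b 2 + b 3 + b 4 ∧
        (b 4 < a 4 ∨ a 4 = b 4 ∧ (b 3 < a 3 ∨ a 3 = b 3 ∧ (b 2 < a 2 ∨ a 2 = b 2 ∧
          (b 1 < a 1 ∨ a 1 = b 1 ∧ b 0 < a 0))))) := by
  have hs : ∀ c : Fin 5 →₀ ℕ, (c.sum fun _ n => n) = c 0 + c 1 + c 2 + c 3 + c 4 := by
    intro c
    rw [Finsupp.sum_fintype _ _ (fun _ => rfl), Fin.sum_univ_five]
  unfold RevLexLT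
  rw [hs, hs]
  simp only [Fin.exists_fin_succ, Fin.forall_fin_succ]
  simp [Fin.lt_def]
  omega

theorem RevLexLT.trans {a b c : Fin 5 →₀ ℕ} (hab : RevLexLT a b) (hbc : RevLexLT b c) :
    RevLexLT a c := by
  rw [revLexLT_iff] at *
  omega

theorem RevLexLT.ne {a b : Fin 5 →₀ ℕ} (h : RevLexLT a b) : a ≠ b := by
  rintro rfl
  rw [revLexLT_iff] at h
  omega

theorem revLexLT_or_gt_of_ne {a b : Fin 5 →₀ ℕ} (h : a ≠ b) : RevLexLT a b ∨ RevLexLT b a := by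
  by_contra hn
  apply h
  rw [revLexLT_iff, revLexLT_iff] at hn
  ext i
  fin_cases i <;> simp <;> omega

theorem RevLexLT.add_right {a b : Fin 5 →₀ ℕ} (h : RevLexLT a b) (c : Fin 5 →₀ ℕ) :
    RevLexLT (a + c) (b + c) := by
  rw [revLexLT_iff] at *
  simp only [Finsupp.add_apply]
  omega

theorem RevLexLT.add_left {a b : Fin 5 →₀ ℕ} (h : RevLexLT a b) (c : Fin 5 →₀ ℕ) :
    RevLexLT (c + a) (c + b) := by
  rw [add_comm c a, add_comm c b]
  exact h.add_right c

theorem exists_isLeadExp {h : MvPolynomial (Fin 5) ℂ} (h0 : h ≠ 0) : ∃ d, IsLeadExp h d := by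
  have key : ∀ s : Finset (Fin 5 →₀ ℕ), s.Nonempty →
      ∃ d ∈ s, ∀ e ∈ s, e ≠ d → RevLexLT e d := by
    intro s hs
    induction hs using Finset.Nonempty.cons_induction with
    | singleton a => exact ⟨a, by simp, by simp⟩
    | cons a s ha hs ih =>
      obtain ⟨d, hd, hmax⟩ := ih
      have had : a ≠ d := by rintro rfl; exact ha hd
      rcases revLexLT_or_gt_of_ne had with hlt | hlt
      · refine ⟨d, Finset.mem_cons_of_mem hd, fun e he hne => ?_⟩
        rcases Finset.mem_cons.1 he with rfl | he
        · exact hlt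
        · exact hmax e he hne
      · refine ⟨a, Finset.mem_cons_self a s, fun e he hne => ?_⟩
        rcases Finset.mem_cons.1 he with rfl | he
        · exact absurd rfl hne
        · by_cases hed : e = d
          · exact hed ▸ hlt
          · exact (hmax e he hed).trans hlt
  exact key h.support (Finset.nonempty_iff_ne_empty.2 (by simpa using h0))

theorem IsLeadExp.unique {h : MvPolynomial (Fin 5) ℂ} {d e : Fin 5 →₀ ℕ}
    (hd : IsLeadExp h d) (he : IsLeadExp h e) : d = e := by
  by_contra hne
  exact ((hd.2 e he.1 (Ne.symm hne)).trans (he.2 d hd.1 hne)).ne rfl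

theorem IsLeadExp.mul {p q : MvPolynomial (Fin 5) ℂ} {d e : Fin 5 →₀ ℕ}
    (hp : IsLeadExp p d) (hq : IsLeadExp q e) : IsLeadExp (p * q) (d + e) := by
  have hlt : ∀ a ∈ p.support, ∀ b ∈ q.support, (a, b) ≠ (d, e) → RevLexLT (a + b) (d + e) := by
    intro a ha b hb hne
    by_cases had : a = d
    · subst had
      exact (hq.2 b hb (by rintro rfl; exact hne rfl)).add_left a
    · by_cases hbe : b = e
      · subst hbe
        exact (hp.2 a ha had).add_right b
      · exact ((hp.2 a ha had).add_right b).trans ((hq.2 b hb hbe).add_left d)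
  constructor
  · rw [mem_support_iff, coeff_mul, Finset.sum_eq_single (d, e)]
    · exact mul_ne_zero (mem_support_iff.1 hp.1) (mem_support_iff.1 hq.1)
    · rintro ⟨a, b⟩ hab hne
      by_contra h0
      have hab' : a + b = d + e := by simpa using hab
      exact (hlt a (mem_support_iff.2 (left_ne_zero_of_mul h0)) b
        (mem_support_iff.2 (right_ne_zero_of_mul h0)) hne).ne hab'
    · intro h
      simp at h
  · intro c hc hne
    obtain ⟨a, ha, b, hb, rfl⟩ := Finset.mem_add.1 (support_mul p q hc)
    exact hlt a ha b hb (by rintro h; simp_all)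

theorem IsLeadExp.le_of_mul {p q : MvPolynomial (Fin 5) ℂ} {d e : Fin 5 →₀ ℕ}
    (hq : IsLeadExp q e) (hpq : IsLeadExp (p * q) d) : e ≤ d := by
  have hp : p ≠ 0 := by
    rintro rfl
    simpa using hpq.1
  obtain ⟨c, hc⟩ := exists_isLeadExp hp
  rw [hpq.unique (hc.mul hq)]
  exact le_add_self

theorem IsLeadExp.of_support_subset {p q : MvPolynomial (Fin 5) ℂ} {d : Fin 5 →₀ ℕ}
    (hq : IsLeadExp q d) (hsub : p.support ⊆ q.support) (hd : d ∈ p.support) : IsLeadExp p d :=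
  ⟨hd, fun e he hne => hq.2 e (hsub he) hne⟩

theorem isLeadExp_monomial (d : Fin 5 →₀ ℕ) : IsLeadExp (monomial d (1 : ℂ)) d := by
  constructor
  · simp
  · intro e he hne
    exact absurd (by simpa using (support_monomial_subset he)) hne

theorem X_mul_X_eq_monomial (i j : Fin 5) :
    (X i * X j : MvPolynomial (Fin 5) ℂ)
      = monomial (Finsupp.single i 1 + Finsupp.single j 1) 1 := by
  simp [X, monomial_mul]

theorem monomial_mem_of_le {I : Ideal (MvPolynomial (Fin 5) ℂ)} {d e : Fin 5 →₀ ℕ}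
    (hd : monomial d (1 : ℂ) ∈ I) (hde : d ≤ e) : monomial e (1 : ℂ) ∈ I := by
  have : monomial e (1 : ℂ) = monomial (e - d) 1 * monomial d 1 := by
    rw [monomial_mul, tsub_add_cancel_of_le hde, one_mul]
  rw [this]
  exact I.mul_mem_left _ hd

theorem monomial_mem_of_X_mul_X_mem {I : Ideal (MvPolynomial (Fin 5) ℂ)} {i j : Fin 5}
    (hij : i ≠ j) (hI : X i * X j ∈ I) {d : Fin 5 →₀ ℕ} (hi : d i ≠ 0) (hj : d j ≠ 0) :
    monomial d (1 : ℂ) ∈ I := by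
  rw [X_mul_X_eq_monomial] at hI
  refine monomial_mem_of_le hI fun k => ?_
  simp only [Finsupp.add_apply, Finsupp.single_apply]
  split_ifs with h1 h2 h2
  · exact absurd (h1.trans h2.symm) hij
  · subst h1; omega
  · subst h2; omega
  · omega

/-- The exponent vector of a monomial in the ideal `(x₀, x₁) ∩ (x₃, x₄)`. -/
def IsMixed (e : Fin 5 →₀ ℕ) : Prop :=
  (e 0 ≠ 0 ∨ e 1 ≠ 0) ∧ (e 3 ≠ 0 ∨ e 4 ≠ 0)

theorem IsMixed.mono {d e : Fin 5 →₀ ℕ} (hd : IsMixed d) (hde : d ≤ e) : IsMixed e := by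
  have h0 := hde 0
  have h1 := hde 1
  have h3 := hde 3
  have h4 := hde 4
  unfold IsMixed at *
  omega

/-- The ideal of polynomials all of whose monomials are mixed. -/
def mixedIdeal : Ideal (MvPolynomial (Fin 5) ℂ) where
  carrier := {p | ∀ e ∈ p.support, IsMixed e}
  zero_mem' := by simp
  add_mem' := by
    intro p q hp hq e he
    rcases Finset.mem_union.1 (support_add he) with h | h
    · exact hp e h
    · exact hq e h
  smul_mem' := by
    intro c p hp e he
    obtain ⟨a, -, b, hb, rfl⟩ := Finset.mem_add.1 (support_mul c p he)
    exact (hp b hb).mono le_add_self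

theorem mem_mixedIdeal {p : MvPolynomial (Fin 5) ℂ} :
    p ∈ mixedIdeal ↔ ∀ e ∈ p.support, IsMixed e :=
  Iff.rfl

theorem X_mul_X_mem_mixedIdeal {i j : Fin 5} (hi : i = 0 ∨ i = 1) (hj : j = 3 ∨ j = 4) :
    X i * X j ∈ mixedIdeal := by
  rw [X_mul_X_eq_monomial, mem_mixedIdeal]
  intro e he
  rw [Finset.mem_singleton.1 (support_monomial_subset he)]
  rcases hi with rfl | rfl <;> rcases hj with rfl | rfl <;> simp [IsMixed]

theorem exists_add_support_split (P : (Fin 5 →₀ ℕ) → Prop) (p : MvPolynomial (Fin 5) ℂ) :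
    ∃ q r, p = q + r ∧ (∀ e ∈ q.support, P e) ∧ ∀ e ∈ r.support, ¬ P e := by
  induction p using MvPolynomial.induction_on' with
  | monomial u a =>
    by_cases h : P u
    · refine ⟨monomial u a, 0, by simp, fun e he => ?_, by simp⟩
      rwa [Finset.mem_singleton.1 (support_monomial_subset he)]
    · refine ⟨0, monomial u a, by simp, by simp, fun e he => ?_⟩
      rwa [Finset.mem_singleton.1 (support_monomial_subset he)]
  | add p₁ p₂ ih₁ ih₂ =>
    obtain ⟨q₁, r₁, rfl, hq₁, hr₁⟩ := ih₁
    obtain ⟨q₂, r₂, rfl, hq₂, hr₂⟩ := ih₂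
    refine ⟨q₁ + q₂, r₁ + r₂, by ring, fun e he => ?_, fun e he => ?_⟩
    · exact (Finset.mem_union.1 (support_add he)).elim (hq₁ e) (hq₂ e)
    · exact (Finset.mem_union.1 (support_add he)).elim (hr₁ e) (hr₂ e)

theorem forall_mem_support_mul {A B D : (Fin 5 →₀ ℕ) → Prop} {p q : MvPolynomial (Fin 5) ℂ}
    (hp : ∀ e ∈ p.support, A e) (hq : ∀ e ∈ q.support, B e)
    (hAB : ∀ a b, A a → B b → D (a + b)) : ∀ e ∈ (p * q).support, D e := by
  intro e he
  obtain ⟨a, ha, b, hb, rfl⟩ := Finset.mem_add.1 (support_mul p q he)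
  exact hAB a b (hp a ha) (hq b hb)

theorem exists_ne_zero_of_mem_support {p : MvPolynomial (Fin 5) ℂ} {n : ℕ}
    (hp : p.IsHomogeneous n) (hpn : coeff (Finsupp.single 2 n) p = 0) {e : Fin 5 →₀ ℕ}
    (he : e ∈ p.support) : ¬ (e 0 = 0 ∧ e 1 = 0 ∧ e 3 = 0 ∧ e 4 = 0) := by
  rintro ⟨h0, h1, h3, h4⟩
  have he' := mem_support_iff.1 he
  have hdeg : e.degree = n := by
    by_contra hne
    exact he' (hp.coeff_eq_zero hne)
  rw [Finsupp.degree_eq_sum, Fin.sum_univ_five] at hdeg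
  have : e = Finsupp.single 2 n := by
    ext i
    fin_cases i <;> simp [h0, h1, h3, h4]
    omega
  exact he' (this ▸ hpn)

theorem isLeadExp_mem_of_mem_sup {f g : MvPolynomial (Fin 5) ℂ}
    (hf : ∀ e ∈ f.support, (e 3 = 0 ∧ e 4 = 0) ∧ (e 0 ≠ 0 ∨ e 1 ≠ 0))
    (hg : ∀ e ∈ g.support, (e 0 = 0 ∧ e 1 = 0) ∧ (e 3 ≠ 0 ∨ e 4 ≠ 0))
    {df dg : Fin 5 →₀ ℕ} (hdf : IsLeadExp f df) (hdg : IsLeadExp g dg)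
    {h : MvPolynomial (Fin 5) ℂ} (hh : h ∈ mixedIdeal ⊔ Ideal.span {f} ⊔ Ideal.span {g})
    {d : Fin 5 →₀ ℕ} (hd : IsLeadExp h d) : IsMixed d ∨ df ≤ d ∨ dg ≤ d := by
  obtain ⟨k, hk, v, hv, rfl⟩ := Submodule.mem_sup.1 hh
  obtain ⟨m, hm, u, hu, rfl⟩ := Submodule.mem_sup.1 hk
  obtain ⟨a, rfl⟩ := Ideal.mem_span_singleton'.1 hu
  obtain ⟨b, rfl⟩ := Ideal.mem_span_singleton'.1 hv
  obtain ⟨a, r, rfl, ha, hr⟩ := exists_add_support_split (fun e => e 3 = 0 ∧ e 4 = 0) a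
  obtain ⟨b, s, rfl, hb, hs⟩ := exists_add_support_split (fun e => e 0 = 0 ∧ e 1 = 0) b
  have hrf : r * f ∈ mixedIdeal := forall_mem_support_mul hr hf (by
    intro a b; simp only [IsMixed, Finsupp.add_apply]; omega)
  have hsg : s * g ∈ mixedIdeal := forall_mem_support_mul hs hg (by
    intro a b; simp only [IsMixed, Finsupp.add_apply]; omega)
  have haf : ∀ e ∈ (a * f).support, (e 3 = 0 ∧ e 4 = 0) ∧ (e 0 ≠ 0 ∨ e 1 ≠ 0) :=
    forall_mem_support_mul ha hf (by intro a b; simp only [Finsupp.add_apply]; omega)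
  have hbg : ∀ e ∈ (b * g).support, (e 0 = 0 ∧ e 1 = 0) ∧ (e 3 ≠ 0 ∨ e 4 ≠ 0) :=
    forall_mem_support_mul hb hg (by intro a b; simp only [Finsupp.add_apply]; omega)
  have heq : m + (a + r) * f + (b + s) * g = (m + r * f + s * g) + a * f + b * g := by ring
  rw [heq] at hd
  have hM : m + r * f + s * g ∈ mixedIdeal := add_mem (add_mem hm hrf) hsg
  generalize m + r * f + s * g = M at hd hM
  rw [mem_mixedIdeal] at hM
  have hafsub : (a * f).support ⊆ (M + a * f + b * g).support := by
    intro e he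
    have h1 : coeff e M = 0 := by
      by_contra h
      have := (hM e (mem_support_iff.2 h)).2
      have := (haf e he).1
      omega
    have h2 : coeff e (b * g) = 0 := by
      by_contra h
      have := (hbg e (mem_support_iff.2 h)).1
      have := (haf e he).2
      omega
    rw [mem_support_iff, coeff_add, coeff_add, h1, h2, zero_add, add_zero]
    exact mem_support_iff.1 he
  have hbgsub : (b * g).support ⊆ (M + a * f + b * g).support := by
    intro e he
    have h1 : coeff e M = 0 := by
      by_contra h
      have := (hM e (mem_support_iff.2 h)).1
      have := (hbg e he).1
      omega
    have h2 : coeff e (a * f) = 0 := by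
      by_contra h
      have := (haf e (mem_support_iff.2 h)).2
      have := (hbg e he).1
      omega
    rw [mem_support_iff, coeff_add, coeff_add, h1, h2, zero_add, zero_add]
    exact mem_support_iff.1 he
  rcases Finset.mem_union.1 (support_add hd.1) with h | h
  · rcases Finset.mem_union.1 (support_add h) with h | h
    · exact Or.inl (hM d h)
    · exact Or.inr (Or.inl (hdf.le_of_mul (hd.of_support_subset hafsub h)))
  · exact Or.inr (Or.inr (hdg.le_of_mul (hd.of_support_subset hbgsub h)))

/-- Let `f` (resp. `g`) be a nonzero homogeneous quintic in
`x₀,x₁,x₂` (resp. `x₂,x₃,x₄`) only, each with zero coefficient of `x₂⁵`, and let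
`I_C = (x₁x₄, x₀x₄, x₁x₃, x₀x₃, f, g)`.  Then the initial ideal of `I_C` for the
degrevlex order is `(x₁x₄, x₀x₄, x₁x₃, x₀x₃, lm f, lm g)`.  In particular `I_C`
admits a Gröbner basis consisting of elements of degree at most 5. -/
theorem stmt_13 (f g : MvPolynomial (Fin 5) ℂ) (hf0 : f ≠ 0) (hg0 : g ≠ 0)
    (hf5 : f.IsHomogeneous 5)
    (hfvars : ∀ e ∈ f.support, e 3 = 0 ∧ e 4 = 0)
    (hfx2 : coeff (Finsupp.single 2 5) f = 0)
    (hg5 : g.IsHomogeneous 5)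
    (hgvars : ∀ e ∈ g.support, e 0 = 0 ∧ e 1 = 0)
    (hgx2 : coeff (Finsupp.single 2 5) g = 0)
    (df : Fin 5 →₀ ℕ) (hdf : IsLeadExp f df)
    (dg : Fin 5 →₀ ℕ) (hdg : IsLeadExp g dg)
    (IC : Ideal (MvPolynomial (Fin 5) ℂ))
    (hIC : IC = Ideal.span {X 1 * X 4, X 0 * X 4, X 1 * X 3, X 0 * X 3, f, g}) :
    initialIdeal IC
        = Ideal.span {X 1 * X 4, X 0 * X 4, X 1 * X 3, X 0 * X 3,
            monomial df (1 : ℂ), monomial dg (1 : ℂ)} ∧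
      ∃ B : Finset (MvPolynomial (Fin 5) ℂ),
        (∀ h ∈ B, h ∈ IC) ∧ (∀ h ∈ B, h.totalDegree ≤ 5) ∧
          initialIdeal IC = Ideal.span
            {p | ∃ h ∈ B, ∃ d : Fin 5 →₀ ℕ, IsLeadExp h d ∧ p = monomial d (1 : ℂ)} := by
  classical
  have hf : ∀ e ∈ f.support, (e 3 = 0 ∧ e 4 = 0) ∧ (e 0 ≠ 0 ∨ e 1 ≠ 0) := by
    intro e he
    have h1 := hfvars e he
    have h2 := exists_ne_zero_of_mem_support hf5 hfx2 he
    omega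
  have hg : ∀ e ∈ g.support, (e 0 = 0 ∧ e 1 = 0) ∧ (e 3 ≠ 0 ∨ e 4 ≠ 0) := by
    intro e he
    have h1 := hgvars e he
    have h2 := exists_ne_zero_of_mem_support hg5 hgx2 he
    omega
  let B : Finset (MvPolynomial (Fin 5) ℂ) := {X 1 * X 4, X 0 * X 4, X 1 * X 3, X 0 * X 3, f, g}
  have hIC' : IC ≤ mixedIdeal ⊔ Ideal.span {f} ⊔ Ideal.span {g} := by
    rw [hIC, Ideal.span_le]
    have hmix : ∀ p ∈ mixedIdeal, p ∈ mixedIdeal ⊔ Ideal.span {f} ⊔ Ideal.span {g} :=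
      fun p hp => Ideal.mem_sup_left (Ideal.mem_sup_left hp)
    rintro p (rfl | rfl | rfl | rfl | rfl | rfl)
    · exact hmix _ (X_mul_X_mem_mixedIdeal (by simp) (by simp))
    · exact hmix _ (X_mul_X_mem_mixedIdeal (by simp) (by simp))
    · exact hmix _ (X_mul_X_mem_mixedIdeal (by simp) (by simp))
    · exact hmix _ (X_mul_X_mem_mixedIdeal (by simp) (by simp))
    · exact Ideal.mem_sup_left (Ideal.mem_sup_right (Ideal.mem_span_singleton_self _))
    · exact Ideal.mem_sup_right (Ideal.mem_span_singleton_self _)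
  have hB : ∀ h ∈ B, h ∈ IC := by
    intro h hh
    rw [hIC]
    exact Ideal.subset_span (by simpa [B] using hh)
  have hinit : initialIdeal IC ≤ Ideal.span {X 1 * X 4, X 0 * X 4, X 1 * X 3, X 0 * X 3,
      monomial df (1 : ℂ), monomial dg (1 : ℂ)} := by
    refine Ideal.span_le.2 ?_
    rintro _ ⟨h, hh, d, hd, rfl⟩
    rcases isLeadExp_mem_of_mem_sup hf hg hdf hdg (hIC' hh) hd with hmix | hle | hle
    · rcases hmix with ⟨hi | hi, hj | hj⟩ <;>
        exact monomial_mem_of_X_mul_X_mem (by decide) (Ideal.subset_span (by simp)) hi hj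
    · exact monomial_mem_of_le (Ideal.subset_span (by simp)) hle
    · exact monomial_mem_of_le (Ideal.subset_span (by simp)) hle
  have hlead : Ideal.span {X 1 * X 4, X 0 * X 4, X 1 * X 3, X 0 * X 3,
      monomial df (1 : ℂ), monomial dg (1 : ℂ)} ≤ Ideal.span
        {p | ∃ h ∈ B, ∃ d : Fin 5 →₀ ℕ, IsLeadExp h d ∧ p = monomial d (1 : ℂ)} := by
    have hXX : ∀ i j : Fin 5, (X i * X j : MvPolynomial (Fin 5) ℂ) ∈ B →
        X i * X j ∈ Ideal.span
          {p | ∃ h ∈ B, ∃ d : Fin 5 →₀ ℕ, IsLeadExp h d ∧ p = monomial d (1 : ℂ)} := by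
      intro i j hij
      refine Ideal.subset_span ⟨_, hij, _, ?_, X_mul_X_eq_monomial i j⟩
      rw [X_mul_X_eq_monomial]
      exact isLeadExp_monomial _
    rw [Ideal.span_le]
    rintro p (rfl | rfl | rfl | rfl | rfl | rfl)
    · exact hXX _ _ (by simp [B])
    · exact hXX _ _ (by simp [B])
    · exact hXX _ _ (by simp [B])
    · exact hXX _ _ (by simp [B])
    · exact Ideal.subset_span ⟨f, by simp [B], df, hdf, rfl⟩
    · exact Ideal.subset_span ⟨g, by simp [B], dg, hdg, rfl⟩
  have hBinit : Ideal.span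
      {p | ∃ h ∈ B, ∃ d : Fin 5 →₀ ℕ, IsLeadExp h d ∧ p = monomial d (1 : ℂ)}
        ≤ initialIdeal IC :=
    Ideal.span_mono fun _ ⟨h, hh, hd⟩ => ⟨h, hB h hh, hd⟩
  refine ⟨le_antisymm hinit (hlead.trans hBinit), B, hB, ?_,
    le_antisymm (hinit.trans hlead) hBinit⟩
  have hXX : ∀ i j : Fin 5, (X i * X j : MvPolynomial (Fin 5) ℂ).totalDegree ≤ 5 := by
    intro i j
    refine (totalDegree_mul _ _).trans ?_
    simp [totalDegree_X]
  intro h hh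
  simp only [B, Finset.mem_insert, Finset.mem_singleton] at hh
  rcases hh with rfl | rfl | rfl | rfl | rfl | rfl
  · exact hXX _ _
  · exact hXX _ _
  · exact hXX _ _
  · exact hXX _ _
  · exact hf5.totalDegree_le
  · exact hg5.totalDegree_le
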